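/- Let C be a smooth plane cubic in ℙ²(ℂ) and let n ∈ C be a point that is not an inflection point of C. Then there are exactly four distinct lines L through n such that L is tangent to C at some point q ≠ n. -/

import Mathlib

open MvPolynomial

noncomputable section

abbrev P2 : Type := Projectivization ℂ (Fin 3 → ℂ)

/-- The zero locus in `ℙ²` of a polynomial `F`: the points all of whose
representative vectors are zeros of `F`. -/
def curve (F : MvPolynomial (Fin 3) ℂ) : Set P2 :=
  {p | ∀ (w : Fin 3 → ℂ) (hw : w ≠ 0), Projectivization.mk ℂ w hw = p → eval w F = 0}

/-- The projective line spanned by two vectors. -/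
def lineThrough (u v : Fin 3 → ℂ) : Set P2 :=
  {p | ∃ s t : ℂ, ∃ h : s • u + t • v ≠ 0, p = Projectivization.mk ℂ (s • u + t • v) h}

/-- A subset of `ℙ²` is a line if it is the projective span of two
linearly independent vectors. -/
def IsLine (S : Set P2) : Prop :=
  ∃ u v : Fin 3 → ℂ, LinearIndependent ℂ ![u, v] ∧ S = lineThrough u v

/-- The restriction of `F` to the affine parametrization `t ↦ a + t • b` of the line
through `[a]` and `[b]`, as a polynomial in `t`. -/
def lineRest (F : MvPolynomial (Fin 3) ℂ) (a b : Fin 3 → ℂ) : Polynomial ℂ :=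
  eval₂ Polynomial.C (fun i => Polynomial.C (a i) + Polynomial.X * Polynomial.C (b i)) F

/-- The local intersection multiplicity, at the point `[a]`, of the curve `F = 0` with the
line through `[a]` and `[b]` (parametrized by `t ↦ a + t • b`, the point `[a]`
corresponding to `t = 0`). -/
def multAt (F : MvPolynomial (Fin 3) ℂ) (a b : Fin 3 → ℂ) : ℕ :=
  Polynomial.rootMultiplicity 0 (lineRest F a b)

/-- The scheme `X ∩ L` (for `X = {F = 0}`, `L` a line) is everywhere nonreduced: at each
point of `X ∩ L` the local intersection multiplicity is at least `2`.  (Stated over all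
parametrizations of `L`; the base point `a` of a parametrization is a point of `L`, and
every point of `L` occurs as such a base point.) -/
def EverywhereTangent (F : MvPolynomial (Fin 3) ℂ) (S : Set P2) : Prop :=
  ∀ a b : Fin 3 → ℂ, LinearIndependent ℂ ![a, b] → S = lineThrough a b →
    ∀ ha : a ≠ 0, Projectivization.mk ℂ a ha ∈ curve F → 2 ≤ multAt F a b

/-- A theta-line of the quartic `F`: either contained in the curve, or intersecting it
everywhere nonreducedly. -/
def ThetaLine (F : MvPolynomial (Fin 3) ℂ) (S : Set P2) : Prop :=
  IsLine S ∧ (S ⊆ curve F ∨ EverywhereTangent F S)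

/-- A bitangent line of (a smooth curve) `F = 0`: a line, not contained in the curve,
whose scheme-theoretic intersection with the curve is everywhere nonreduced. -/
def Bitangent (F : MvPolynomial (Fin 3) ℂ) (S : Set P2) : Prop :=
  IsLine S ∧ ¬ S ⊆ curve F ∧ EverywhereTangent F S

/-- The line `S` is tangent to the curve `F = 0` at the point `q`: the local intersection
multiplicity there is at least `2`. -/
def TangentAt (F : MvPolynomial (Fin 3) ℂ) (S : Set P2) (q : P2) : Prop :=
  IsLine S ∧ q ∈ S ∧ q ∈ curve F ∧
    ∀ a b : Fin 3 → ℂ, LinearIndependent ℂ ![a, b] → S = lineThrough a b →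
      ∀ ha : a ≠ 0, Projectivization.mk ℂ a ha = q → 2 ≤ multAt F a b

/-- The curve `F = 0` is smooth: `F` and its partial derivatives have no common
projective zero. -/
def SmoothCurve (F : MvPolynomial (Fin 3) ℂ) : Prop :=
  ∀ w : Fin 3 → ℂ, w ≠ 0 → ¬ (eval w F = 0 ∧ ∀ i : Fin 3, eval w (pderiv i F) = 0)

/-- Iterated partial derivative along a list of coordinate directions. -/
def pderivList (l : List (Fin 3)) (F : MvPolynomial (Fin 3) ℂ) : MvPolynomial (Fin 3) ℂ :=
  l.foldr (fun i G => pderiv i G) F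

/-- `F` vanishes to order at least `m` at the point `p` (all partial derivatives of
order `< m` vanish at `p`); i.e. `p` is a point of multiplicity at least `m` of `F = 0`. -/
def VanishesToOrder (F : MvPolynomial (Fin 3) ℂ) (p : P2) (m : ℕ) : Prop :=
  ∀ l : List (Fin 3), l.length < m →
    ∀ (w : Fin 3 → ℂ) (hw : w ≠ 0), Projectivization.mk ℂ w hw = p →
      eval w (pderivList l F) = 0

/-- `p` is a singular point of the curve `F = 0`. -/
def IsSingularAt (F : MvPolynomial (Fin 3) ℂ) (p : P2) : Prop :=
  VanishesToOrder F p 2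

/-- `p` is a double point: a point of multiplicity exactly `2`. -/
def IsDoublePoint (F : MvPolynomial (Fin 3) ℂ) (p : P2) : Prop :=
  VanishesToOrder F p 2 ∧ ¬ VanishesToOrder F p 3

/-- The quadratic form (in the direction `b`) cutting out the tangent cone of `F = 0`
at the double point `[a]`: the degree-`2` Taylor coefficient of `t ↦ F (a + t • b)`. -/
def coneCoeff (F : MvPolynomial (Fin 3) ℂ) (a b : Fin 3 → ℂ) : ℂ :=
  (lineRest F a b).coeff 2

/-- `p` is an ordinary node: a double point whose tangent cone consists of two distinct
lines, i.e. the tangent-cone quadratic has two null directions independent modulo `a`. -/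
def OrdinaryNode (F : MvPolynomial (Fin 3) ℂ) (p : P2) : Prop :=
  IsDoublePoint F p ∧
    ∀ (a : Fin 3 → ℂ) (ha : a ≠ 0), Projectivization.mk ℂ a ha = p →
      ∃ b₁ b₂ : Fin 3 → ℂ, LinearIndependent ℂ ![a, b₁, b₂] ∧
        coneCoeff F a b₁ = 0 ∧ coneCoeff F a b₂ = 0

/-- At the double point `[a]`, the tangent cone is the double line through `[a]` and
`[b₀]`: `b₀` is a null direction of the tangent-cone quadratic, and every null
direction lies on the line spanned by `a` and `b₀`. -/
def DoubleLineCone (F : MvPolynomial (Fin 3) ℂ) (a b₀ : Fin 3 → ℂ) : Prop :=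
  LinearIndependent ℂ ![a, b₀] ∧ coneCoeff F a b₀ = 0 ∧
    ∀ b : Fin 3 → ℂ, coneCoeff F a b = 0 → b ∈ Submodule.span ℂ ({a, b₀} : Set (Fin 3 → ℂ))

/-- `p` is an ordinary cusp: a double point whose tangent cone is a double line `L₀`
with local intersection multiplicity `i(L₀ · X) = 3` at `p`. -/
def OrdinaryCusp (F : MvPolynomial (Fin 3) ℂ) (p : P2) : Prop :=
  IsDoublePoint F p ∧
    ∀ (a : Fin 3 → ℂ) (ha : a ≠ 0), Projectivization.mk ℂ a ha = p →
      ∃ b₀ : Fin 3 → ℂ, DoubleLineCone F a b₀ ∧ multAt F a b₀ = 3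

/-- `p` is an ordinary tacnode: a double point whose tangent cone is a double line `L₀`
with local intersection multiplicity `i(L₀ · X) = 4` at `p`. -/
def OrdinaryTacnode (F : MvPolynomial (Fin 3) ℂ) (p : P2) : Prop :=
  IsDoublePoint F p ∧
    ∀ (a : Fin 3 → ℂ) (ha : a ≠ 0), Projectivization.mk ℂ a ha = p →
      ∃ b₀ : Fin 3 → ℂ, DoubleLineCone F a b₀ ∧ multAt F a b₀ = 4

/-- A theta-line of type `i`: a theta-line, not a component of the curve, containing
exactly `i` singular points of the curve. -/
def ThetaLineOfType (F : MvPolynomial (Fin 3) ℂ) (i : ℕ) (S : Set P2) : Prop :=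
  ThetaLine F S ∧ ¬ S ⊆ curve F ∧ {p | p ∈ S ∧ IsSingularAt F p}.ncard = i

/-- Three points of `ℙ²` are collinear. -/
def Collin (p q r : P2) : Prop :=
  ∃ S : Set P2, IsLine S ∧ p ∈ S ∧ q ∈ S ∧ r ∈ S


/-- An ordinary bitangent: a bitangent meeting the curve at exactly two distinct points,
each with local intersection multiplicity exactly `2`. -/
def OrdinaryBitangent (F : MvPolynomial (Fin 3) ℂ) (S : Set P2) : Prop :=
  Bitangent F S ∧ (S ∩ curve F).ncard = 2 ∧
    ∀ a b : Fin 3 → ℂ, LinearIndependent ℂ ![a, b] → S = lineThrough a b →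
      ∀ ha : a ≠ 0, Projectivization.mk ℂ a ha ∈ curve F → multAt F a b = 2

/-- A bitangent meeting the curve only at smooth points. -/
def SmoothBitangent (F : MvPolynomial (Fin 3) ℂ) (S : Set P2) : Prop :=
  Bitangent F S ∧ ∀ p ∈ S ∩ curve F, ¬ IsSingularAt F p

theorem eval_lineRest (F : MvPolynomial (Fin 3) ℂ) (a b : Fin 3 → ℂ) (t : ℂ) :
    (lineRest F a b).eval t = eval (a + t • b) F := by
  unfold lineRest
  induction F using MvPolynomial.induction_on with
  | C r => simp
  | add p q hp hq => simp only [eval₂_add, Polynomial.eval_add, hp, hq, map_add]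
  | mul_X p i hp =>
    simp only [eval₂_mul, eval₂_X, Polynomial.eval_mul, hp]
    simp [-Polynomial.X_mul_C]

/-- The differential of `F` at `w`. -/
def grad (F : MvPolynomial (Fin 3) ℂ) (w : Fin 3 → ℂ) : (Fin 3 → ℂ) →ₗ[ℂ] ℂ :=
  ∑ i, eval w (pderiv i F) • LinearMap.proj i

theorem grad_apply (F : MvPolynomial (Fin 3) ℂ) (w d : Fin 3 → ℂ) :
    grad F w d = ∑ i, eval w (pderiv i F) * d i := by
  simp [grad]

theorem eval_derivative_lineRest (F : MvPolynomial (Fin 3) ℂ) (a b : Fin 3 → ℂ) :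
    (lineRest F a b).derivative.eval 0 = grad F a b := by
  rw [grad_apply]
  induction F using MvPolynomial.induction_on with
  | C r => simp [lineRest]
  | add p q hp hq =>
    have h : lineRest (p + q) a b = lineRest p a b + lineRest q a b := by simp [lineRest]
    simp [h, hp, hq, add_mul, Finset.sum_add_distrib]
  | mul_X p i hp =>
    have h : lineRest (p * X i) a b
        = lineRest p a b * (Polynomial.C (a i) + Polynomial.X * Polynomial.C (b i)) := by
      simp [lineRest]
    have h0 : (lineRest p a b).eval 0 = eval a p := by simp [eval_lineRest]
    rw [h, Polynomial.derivative_mul, Polynomial.eval_add, Polynomial.eval_mul, hp,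
      Polynomial.eval_mul, h0]
    fin_cases i <;> simp [Fin.sum_univ_three, pderiv_X, Pi.single_apply] <;> ring

theorem lineRest_eq_of_eval {F : MvPolynomial (Fin 3) ℂ} {a b : Fin 3 → ℂ} {p : Polynomial ℂ}
    (h : ∀ t, eval (a + t • b) F = p.eval t) : lineRest F a b = p :=
  Polynomial.funext fun t => by rw [eval_lineRest, h]

theorem grad_eq_of_eval {F : MvPolynomial (Fin 3) ℂ} {w d : Fin 3 → ℂ} (e₀ e₁ e₂ e₃ : ℂ)
    (h : ∀ t, eval (w + t • d) F = e₀ + e₁ * t + e₂ * t ^ 2 + e₃ * t ^ 3) :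
    grad F w d = e₁ := by
  have : lineRest F w d = Polynomial.C e₀ + Polynomial.C e₁ * Polynomial.X
      + Polynomial.C e₂ * Polynomial.X ^ 2 + Polynomial.C e₃ * Polynomial.X ^ 3 :=
    lineRest_eq_of_eval fun t => by simp [h]
  rw [← eval_derivative_lineRest, this]
  simp

theorem SmoothCurve.grad_ne_zero {F : MvPolynomial (Fin 3) ℂ} (hsm : SmoothCurve F)
    {w : Fin 3 → ℂ} (hw : w ≠ 0) (h : eval w F = 0) : grad F w ≠ 0 := fun hg =>
  hsm w hw ⟨h, fun i => by
    have := LinearMap.congr_fun hg (Pi.single i 1)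
    simpa [grad_apply, Pi.single_apply] using this⟩

/-- The ternary cubic form with the given ten coefficients. -/
def cubicForm (k : Fin 10 → ℂ) (s x y : ℂ) : ℂ :=
  k 0 * s ^ 3 + k 1 * s ^ 2 * x + k 2 * s ^ 2 * y + s * (k 3 * x ^ 2 + k 4 * x * y + k 5 * y ^ 2)
    + (k 6 * x ^ 3 + k 7 * x ^ 2 * y + k 8 * x * y ^ 2 + k 9 * y ^ 3)

theorem exists_cubicForm_of_mul (u v w : Fin 3 → ℂ) (r : ℂ) : ∃ k, ∀ s x y : ℂ,
    r * ((s * u 0 + x * u 1 + y * u 2) * (s * v 0 + x * v 1 + y * v 2)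
      * (s * w 0 + x * w 1 + y * w 2)) = cubicForm k s x y := by
  refine ⟨![r * (u 0 * v 0 * w 0), r * (u 0 * v 0 * w 1 + u 0 * v 1 * w 0 + u 1 * v 0 * w 0),
    r * (u 0 * v 0 * w 2 + u 0 * v 2 * w 0 + u 2 * v 0 * w 0),
    r * (u 0 * v 1 * w 1 + u 1 * v 0 * w 1 + u 1 * v 1 * w 0),
    r * (u 0 * v 1 * w 2 + u 0 * v 2 * w 1 + u 1 * v 0 * w 2 + u 1 * v 2 * w 0
      + u 2 * v 0 * w 1 + u 2 * v 1 * w 0),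
    r * (u 0 * v 2 * w 2 + u 2 * v 0 * w 2 + u 2 * v 2 * w 0),
    r * (u 1 * v 1 * w 1), r * (u 1 * v 1 * w 2 + u 1 * v 2 * w 1 + u 2 * v 1 * w 1),
    r * (u 1 * v 2 * w 2 + u 2 * v 1 * w 2 + u 2 * v 2 * w 1), r * (u 2 * v 2 * w 2)],
    fun s x y => ?_⟩
  simp [cubicForm]
  ring

theorem exists_cubicForm {F : MvPolynomial (Fin 3) ℂ} (hF : F.IsHomogeneous 3)
    (B : Fin 3 → Fin 3 → ℂ) :
    ∃ k, ∀ s x y : ℂ, eval (s • B 0 + x • B 1 + y • B 2) F = cubicForm k s x y := by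
  have key : ∀ T ⊆ F.support, ∃ k, ∀ s x y : ℂ,
      ∑ d ∈ T, coeff d F * ∏ i, (s • B 0 + x • B 1 + y • B 2) i ^ d i = cubicForm k s x y := by
    intro T
    induction T using Finset.induction_on with
    | empty => exact fun _ => ⟨0, by simp [cubicForm]⟩
    | insert d T hd ih =>
      intro hT
      obtain ⟨k, hk⟩ := ih fun e he => hT (Finset.mem_insert_of_mem he)
      have hdeg : d 0 + d 1 + d 2 = 3 := by
        have := hF (mem_support_iff.1 (hT (Finset.mem_insert_self d T)))
        simpa [Finsupp.weight_apply, Finsupp.sum_fintype, Fin.sum_univ_three] using this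
      have hprod : ∃ i j l : Fin 3, ∀ w : Fin 3 → ℂ, ∏ i, w i ^ d i = w i * w j * w l := by
        have h0 : d 0 ≤ 3 := by omega
        have h1 : d 1 ≤ 3 := by omega
        have h2 : d 2 = 3 - d 0 - d 1 := by omega
        simp only [Fin.prod_univ_three, h2]
        generalize d 0 = m at *
        generalize d 1 = n at *
        interval_cases m <;> interval_cases n <;> first
          | omega
          | exact ⟨0, 0, 0, fun w => by ring1⟩
          | exact ⟨0, 0, 1, fun w => by ring1⟩
          | exact ⟨0, 0, 2, fun w => by ring1⟩
          | exact ⟨0, 1, 1, fun w => by ring1⟩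
          | exact ⟨0, 1, 2, fun w => by ring1⟩
          | exact ⟨0, 2, 2, fun w => by ring1⟩
          | exact ⟨1, 1, 1, fun w => by ring1⟩
          | exact ⟨1, 1, 2, fun w => by ring1⟩
          | exact ⟨1, 2, 2, fun w => by ring1⟩
          | exact ⟨2, 2, 2, fun w => by ring1⟩
      obtain ⟨i, j, l, hijl⟩ := hprod
      obtain ⟨k', hk'⟩ := exists_cubicForm_of_mul (fun m => B m i) (fun m => B m j)
        (fun m => B m l) (coeff d F)
      refine ⟨k' + k, fun s x y => ?_⟩
      rw [Finset.sum_insert hd, hk, hijl]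
      simp only [Pi.add_apply, Pi.smul_apply, smul_eq_mul, hk']
      simp only [cubicForm, Pi.add_apply]
      ring
  obtain ⟨k, hk⟩ := key F.support subset_rfl
  exact ⟨k, fun s x y => by rw [eval_eq', hk]⟩

theorem mk_mem_lineThrough {u v z : Fin 3 → ℂ} (hz : z ≠ 0) :
    Projectivization.mk ℂ z hz ∈ lineThrough u v ↔ z ∈ Submodule.span ℂ {u, v} := by
  rw [Submodule.mem_span_pair]
  constructor
  · rintro ⟨s, t, h, e⟩
    obtain ⟨r, hr⟩ := (Projectivization.mk_eq_mk_iff' ℂ _ _ hz h).1 e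
    exact ⟨r * s, r * t, by rw [← hr, smul_add, smul_smul, smul_smul]⟩
  · rintro ⟨s, t, rfl⟩
    exact ⟨s, t, hz, rfl⟩

theorem lineThrough_eq_of_mem {u v p r : Fin 3 → ℂ} (huv : LinearIndependent ℂ ![u, v])
    (hpr : LinearIndependent ℂ ![p, r]) (hp : p ∈ Submodule.span ℂ {u, v})
    (hr : r ∈ Submodule.span ℂ {u, v}) : lineThrough u v = lineThrough p r := by
  have hle : Submodule.span ℂ {p, r} ≤ Submodule.span ℂ {u, v} :=
    Submodule.span_le.2 (Set.insert_subset_iff.2 ⟨hp, Set.singleton_subset_iff.2 hr⟩)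
  have h1 := finrank_span_eq_card huv
  have h2 := finrank_span_eq_card hpr
  rw [Matrix.range_cons, Matrix.range_cons, Matrix.range_empty, Set.union_empty,
    Set.singleton_union] at h1 h2
  have heq := Submodule.eq_of_le_of_finrank_eq hle (h2.trans h1.symm)
  ext q
  induction q using Projectivization.ind with
  | h z hz => rw [mk_mem_lineThrough, mk_mem_lineThrough, heq]

theorem exists_adapted_basis {F : MvPolynomial (Fin 3) ℂ} {a : Fin 3 → ℂ} (ha : a ≠ 0)
    (hg : grad F a ≠ 0) (hga : grad F a a = 0) :
    ∃ B : Module.Basis (Fin 3) ℂ (Fin 3 → ℂ),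
      B 0 = a ∧ grad F a (B 1) = 0 ∧ grad F a (B 2) ≠ 0 := by
  obtain ⟨c, hc⟩ : ∃ c, grad F a c ≠ 0 := by
    by_contra! h
    exact hg (LinearMap.ext h)
  have hrank : 1 < Module.finrank ℂ (LinearMap.ker (grad F a)) := by
    have h1 := LinearMap.finrank_range_add_finrank_ker (grad F a)
    have h2 := Submodule.finrank_le (LinearMap.range (grad F a))
    simp at h1 h2
    omega
  obtain ⟨b, hb⟩ := exists_linearIndependent_pair_of_one_lt_finrank hrank
    (x := ⟨a, hga⟩) (by simpa [Subtype.ext_iff] using ha)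
  have hli : LinearIndependent ℂ ![a, b, c] := by
    rw [LinearIndependent.pair_iff] at hb
    rw [Fintype.linearIndependent_iff]
    intro g h
    simp only [Fin.sum_univ_three, Matrix.cons_val] at h
    have h2 : g 2 = 0 := by
      have := congrArg (grad F a) h
      simpa [hga, LinearMap.mem_ker.1 b.2, hc] using this
    have h01 := hb (g 0) (g 1) (by ext1; simpa [h2] using h)
    intro i
    fin_cases i
    exacts [h01.1, h01.2, h2]
  refine ⟨basisOfLinearIndependentOfCardEqFinrank hli (by simp), ?_, ?_, ?_⟩
  · simp
  · simp
  · simpa using hc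

section AdaptedBasis

variable {F : MvPolynomial (Fin 3) ℂ} {B : Module.Basis (Fin 3) ℂ (Fin 3 → ℂ)} {k : Fin 10 → ℂ}

theorem basis_combination (B : Module.Basis (Fin 3) ℂ (Fin 3 → ℂ)) (w : Fin 3 → ℂ) :
    ∃ s x y : ℂ, w = s • B 0 + x • B 1 + y • B 2 :=
  ⟨B.repr w 0, B.repr w 1, B.repr w 2, by
    rw [← Fin.sum_univ_three (fun i => B.repr w i • B i), B.sum_repr]⟩

theorem basis_combination_inj {s x y s' x' y' : ℂ}
    (h : s • B 0 + x • B 1 + y • B 2 = s' • B 0 + x' • B 1 + y' • B 2) :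
    s = s' ∧ x = x' ∧ y = y' := by
  have h' := congrArg B.repr h
  simp only [map_add, map_smul, Module.Basis.repr_self] at h'
  have h0 := DFunLike.congr_fun h' 0
  have h1 := DFunLike.congr_fun h' 1
  have h2 := DFunLike.congr_fun h' 2
  simp at h0 h1 h2
  exact ⟨h0, h1, h2⟩

theorem grad_basis
    (h : ∀ s x y : ℂ, eval (s • B 0 + x • B 1 + y • B 2) F = cubicForm k s x y) (s x y : ℂ) :
    grad F (s • B 0 + x • B 1 + y • B 2) (B 0) = 3 * k 0 * s ^ 2 + 2 * k 1 * s * x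
        + 2 * k 2 * s * y + (k 3 * x ^ 2 + k 4 * x * y + k 5 * y ^ 2) ∧
    grad F (s • B 0 + x • B 1 + y • B 2) (B 1) = k 1 * s ^ 2 + s * (2 * k 3 * x + k 4 * y)
        + 3 * k 6 * x ^ 2 + 2 * k 7 * x * y + k 8 * y ^ 2 ∧
    grad F (s • B 0 + x • B 1 + y • B 2) (B 2) = k 2 * s ^ 2 + s * (k 4 * x + 2 * k 5 * y)
        + k 7 * x ^ 2 + 2 * k 8 * x * y + 3 * k 9 * y ^ 2 := by
  refine ⟨grad_eq_of_eval (cubicForm k s x y) _ (3 * k 0 * s + k 1 * x + k 2 * y) (k 0)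
      fun t => ?_, grad_eq_of_eval (cubicForm k s x y) _ (k 3 * s + 3 * k 6 * x + k 7 * y) (k 6)
      fun t => ?_, grad_eq_of_eval (cubicForm k s x y) _ (k 5 * s + k 8 * x + 3 * k 9 * y) (k 9)
      fun t => ?_⟩
  · rw [show s • B 0 + x • B 1 + y • B 2 + t • B 0 = (s + t) • B 0 + x • B 1 + y • B 2 by module, h]
    simp only [cubicForm]
    ring
  · rw [show s • B 0 + x • B 1 + y • B 2 + t • B 1 = s • B 0 + (x + t) • B 1 + y • B 2 by module, h]
    simp only [cubicForm]
    ring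
  · rw [show s • B 0 + x • B 1 + y • B 2 + t • B 2 = s • B 0 + x • B 1 + (y + t) • B 2 by module, h]
    simp only [cubicForm]
    ring

theorem SmoothCurve.grad_basis_ne_zero (hsm : SmoothCurve F) {s x y : ℂ}
    (hne : ¬ (s = 0 ∧ x = 0 ∧ y = 0)) (h : eval (s • B 0 + x • B 1 + y • B 2) F = 0)
    (h0 : grad F (s • B 0 + x • B 1 + y • B 2) (B 0) = 0)
    (h1 : grad F (s • B 0 + x • B 1 + y • B 2) (B 1) = 0)
    (h2 : grad F (s • B 0 + x • B 1 + y • B 2) (B 2) = 0) : False := by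
  refine hsm.grad_ne_zero (fun hw => hne ?_) h (B.ext fun i => ?_)
  · exact basis_combination_inj (B := B) (by simpa using hw)
  · fin_cases i
    exacts [h0, h1, h2]

theorem linearIndependent_pair_of_basis {s x y : ℂ} (hxy : ¬ (x = 0 ∧ y = 0)) :
    LinearIndependent ℂ ![B 0, s • B 0 + x • B 1 + y • B 2] := by
  rw [LinearIndependent.pair_iff]
  intro p r hpr
  obtain ⟨h0, h1, h2⟩ := basis_combination_inj (B := B) (s := p + r * s) (x := r * x)
    (y := r * y) (s' := 0) (x' := 0) (y' := 0) (by
      rw [zero_smul, zero_smul, zero_smul, add_zero, add_zero, ← hpr]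
      module)
  have hr : r = 0 := by
    by_contra hr
    exact hxy ⟨by simpa [hr] using h1, by simpa [hr] using h2⟩
  exact ⟨by simpa [hr] using h0, hr⟩

/-- The discriminant of the restrictions of a cubic with `k 0 = k 1 = 0` to the lines through the
first basis point, in the affine coordinate `x / y` on this pencil. -/
def discPoly (k : Fin 10 → ℂ) : Polynomial ℂ :=
  (Polynomial.C (k 3) * Polynomial.X ^ 2 + Polynomial.C (k 4) * Polynomial.X
    + Polynomial.C (k 5)) ^ 2
  - Polynomial.C (4 * k 2) * (Polynomial.C (k 6) * Polynomial.X ^ 3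
    + Polynomial.C (k 7) * Polynomial.X ^ 2 + Polynomial.C (k 8) * Polynomial.X
    + Polynomial.C (k 9))

theorem eval_discPoly (k : Fin 10 → ℂ) (x : ℂ) :
    (discPoly k).eval x = (k 3 * x ^ 2 + k 4 * x + k 5) ^ 2
      - 4 * k 2 * (k 6 * x ^ 3 + k 7 * x ^ 2 + k 8 * x + k 9) := by
  simp [discPoly]

theorem natDegree_discPoly (h3 : k 3 ≠ 0) : (discPoly k).natDegree = 4 := by
  have : (discPoly k) = Polynomial.C (k 3 ^ 2) * Polynomial.X ^ 4
      + Polynomial.C (2 * k 3 * k 4 - 4 * k 2 * k 6) * Polynomial.X ^ 3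
      + Polynomial.C (k 4 ^ 2 + 2 * k 3 * k 5 - 4 * k 2 * k 7) * Polynomial.X ^ 2
      + Polynomial.C (2 * k 4 * k 5 - 4 * k 2 * k 8) * Polynomial.X
      + Polynomial.C (k 5 ^ 2 - 4 * k 2 * k 9) :=
    Polynomial.funext fun x => by
      rw [eval_discPoly]
      simp
      ring
  rw [this]
  have := pow_ne_zero 2 h3
  compute_degree!

theorem nodup_roots_discPoly (hsm : SmoothCurve F)
    (h : ∀ s x y : ℂ, eval (s • B 0 + x • B 1 + y • B 2) F = cubicForm k s x y)
    (h0 : k 0 = 0) (h1 : k 1 = 0) (h2 : k 2 ≠ 0) (h3 : k 3 ≠ 0) :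
    (discPoly k).roots.Nodup := by
  have hD : discPoly k ≠ 0 := by
    intro hD
    have := natDegree_discPoly h3
    simp [hD] at this
  rw [Multiset.nodup_iff_count_le_one]
  intro x
  rw [Polynomial.count_roots]
  by_contra! hx
  obtain ⟨hr, hr'⟩ := (Polynomial.one_lt_rootMultiplicity_iff_isRoot hD).1 hx
  rw [Polynomial.IsRoot, eval_discPoly] at hr
  have hd : 2 * (k 3 * x ^ 2 + k 4 * x + k 5) * (2 * k 3 * x + k 4)
      - 4 * k 2 * (3 * k 6 * x ^ 2 + 2 * k 7 * x + k 8) = 0 := by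
    rw [← hr'.eq_zero]
    simp [discPoly, Polynomial.derivative_pow]
    ring
  obtain ⟨s, hs⟩ : ∃ s, 2 * k 2 * s = -(k 3 * x ^ 2 + k 4 * x + k 5) :=
    ⟨-(k 3 * x ^ 2 + k 4 * x + k 5) / (2 * k 2), by field_simp⟩
  obtain ⟨g0, g1, g2⟩ := grad_basis h s x 1
  have hk : (4 : ℂ) * k 2 ≠ 0 := mul_ne_zero (by norm_num) h2
  have e0 : k 2 * s ^ 2 + s * (k 3 * x ^ 2 + k 4 * x + k 5)
      + (k 6 * x ^ 3 + k 7 * x ^ 2 + k 8 * x + k 9) = 0 := by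
    apply (mul_eq_zero_iff_left hk).1
    linear_combination (2 * k 2 * s + (k 3 * x ^ 2 + k 4 * x + k 5)) * hs - hr
  have e1 : s * (2 * k 3 * x + k 4) + 3 * k 6 * x ^ 2 + 2 * k 7 * x + k 8 = 0 := by
    apply (mul_eq_zero_iff_left hk).1
    linear_combination 2 * (2 * k 3 * x + k 4) * hs - hd
  refine hsm.grad_basis_ne_zero (B := B) (s := s) (x := x) (y := 1) (by simp) ?_ ?_ ?_ ?_
  · rw [h, cubicForm, h0, h1]
    linear_combination e0
  · rw [g0, h0, h1]
    linear_combination hs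
  · rw [g1, h1]
    linear_combination e1
  · rw [g2]
    linear_combination 3 * e0 - s * hs - x * e1

theorem card_roots_discPoly (hsm : SmoothCurve F)
    (h : ∀ s x y : ℂ, eval (s • B 0 + x • B 1 + y • B 2) F = cubicForm k s x y)
    (h0 : k 0 = 0) (h1 : k 1 = 0) (h2 : k 2 ≠ 0) (h3 : k 3 ≠ 0) :
    (discPoly k).roots.toFinset.card = 4 := by
  rw [Multiset.toFinset_card_of_nodup (nodup_roots_discPoly hsm h h0 h1 h2 h3),
    ← (IsAlgClosed.splits (discPoly k)).natDegree_eq_card_roots, natDegree_discPoly h3]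

theorem quadratic_coeff_ne_zero (hsm : SmoothCurve F)
    (h : ∀ s x y : ℂ, eval (s • B 0 + x • B 1 + y • B 2) F = cubicForm k s x y)
    (h0 : k 0 = 0) (h1 : k 1 = 0) (h2 : k 2 ≠ 0) (hmult : multAt F (B 0) (B 1) ≤ 2) :
    k 3 ≠ 0 := by
  intro h3
  by_cases h6 : k 6 = 0
  · obtain ⟨s, hs⟩ : ∃ s, k 2 * (s * s) + k 4 * s + k 7 = 0 := by
      obtain ⟨r, hr⟩ := IsAlgClosed.exists_pow_nat_eq (discrim (k 2) (k 4) (k 7)) (n := 2) two_pos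
      exact exists_quadratic_eq_zero h2 ⟨r, by rw [← hr, sq]⟩
    obtain ⟨g0, g1, g2⟩ := grad_basis h s 1 0
    refine hsm.grad_basis_ne_zero (B := B) (s := s) (x := 1) (y := 0) (by simp) ?_ ?_ ?_ ?_
    · rw [h]
      simp [cubicForm, h0, h1, h3, h6]
    · rw [g0]
      simp [h0, h1, h3]
    · rw [g1]
      simp [h1, h3, h6]
    · rw [g2]
      linear_combination hs
  · have : lineRest F (B 0) (B 1) = Polynomial.C (k 6) * (Polynomial.X - Polynomial.C 0) ^ 3 :=
      lineRest_eq_of_eval fun t => by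
        have := h 1 t 0
        simp only [one_smul, zero_smul, add_zero] at this
        simp [this, cubicForm, h0, h1, h3]
    have hne : lineRest F (B 0) (B 1) ≠ 0 := by
      rw [this]
      exact mul_ne_zero (Polynomial.C_ne_zero.2 h6)
        (pow_ne_zero 3 (Polynomial.X_sub_C_ne_zero 0))
    have h3le := (Polynomial.le_rootMultiplicity_iff hne).2 (this ▸ Dvd.intro_left _ rfl)
    exact absurd (h3le.trans hmult) (by norm_num)

theorem tangentAt_of_isRoot
    (h : ∀ s x y : ℂ, eval (s • B 0 + x • B 1 + y • B 2) F = cubicForm k s x y)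
    (h0 : k 0 = 0) (h1 : k 1 = 0) (h2 : k 2 ≠ 0) {x : ℂ} (hx : (discPoly k).eval x = 0) :
    ∃ q, q ≠ Projectivization.mk ℂ (B 0) (B.ne_zero 0) ∧
      TangentAt F (lineThrough (B 0) (x • B 1 + B 2)) q := by
  have hli (s : ℂ) := linearIndependent_pair_of_basis (B := B) (s := s) (x := x) (y := 1) (by simp)
  have hli0 : LinearIndependent ℂ ![B 0, x • B 1 + B 2] := by simpa using hli 0
  obtain ⟨s, hs⟩ : ∃ s, 2 * k 2 * s = -(k 3 * x ^ 2 + k 4 * x + k 5) :=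
    ⟨-(k 3 * x ^ 2 + k 4 * x + k 5) / (2 * k 2), by field_simp⟩
  rw [eval_discPoly] at hx
  have key (p r : ℂ) : eval (p • B 0 + r • (x • B 1 + B 2)) F = k 2 * r * (p - s * r) ^ 2 := by
    rw [show p • B 0 + r • (x • B 1 + B 2) = p • B 0 + (r * x) • B 1 + r • B 2 by module, h,
      cubicForm, h0, h1]
    apply mul_left_cancel₀ (mul_ne_zero (by norm_num : (4 : ℂ) ≠ 0) h2)
    linear_combination (-hx + (k 3 * x ^ 2 + k 4 * x + k 5 - 2 * k 2 * s) * hs) * r ^ 3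
      + 4 * k 2 * p * r ^ 2 * hs
  have hq0 : s • B 0 + x • B 1 + (1 : ℂ) • B 2 ≠ 0 := (hli s).ne_zero 1
  have hq : s • B 0 + x • B 1 + (1 : ℂ) • B 2 = s • B 0 + (1 : ℂ) • (x • B 1 + B 2) := by module
  refine ⟨Projectivization.mk ℂ _ hq0, fun e => ?_, ⟨_, _, hli0, rfl⟩, ?_, ?_, ?_⟩
  · obtain ⟨r, hr⟩ := (Projectivization.mk_eq_mk_iff' ℂ _ _ _ _).1 e
    have := basis_combination_inj (B := B) (s := r) (x := 0) (y := 0) (by rw [← hr]; module)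
    simp at this
  · rw [mk_mem_lineThrough, Submodule.mem_span_pair]
    exact ⟨s, 1, hq.symm⟩
  · intro w hw e
    obtain ⟨r, rfl⟩ := (Projectivization.mk_eq_mk_iff' ℂ _ _ _ _).1 e
    rw [hq, show r • (s • B 0 + (1 : ℂ) • (x • B 1 + B 2))
      = (r * s) • B 0 + r • (x • B 1 + B 2) by module, key]
    ring
  · intro p d hpd hS hp e
    obtain ⟨r, rfl⟩ := (Projectivization.mk_eq_mk_iff' ℂ _ _ _ _).1 e
    have hr : r ≠ 0 := by
      rintro rfl
      simp at hp
    have hd : d ∈ Submodule.span ℂ {B 0, x • B 1 + B 2} := by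
      have hd0 : d ≠ 0 := hpd.ne_zero 1
      rw [← mk_mem_lineThrough hd0, hS, mk_mem_lineThrough]
      exact Submodule.subset_span (by simp)
    obtain ⟨α, β, rfl⟩ := Submodule.mem_span_pair.1 hd
    have hαβ : α - s * β ≠ 0 := by
      intro h'
      have := LinearIndependent.pair_iff.1 hpd β (-r) (by
        rw [sub_eq_zero.1 h']
        module)
      exact hr (neg_eq_zero.1 this.2)
    have hline : lineRest F (r • (s • B 0 + x • B 1 + (1 : ℂ) • B 2)) (α • B 0 + β • (x • B 1 + B 2))
        = (Polynomial.X - Polynomial.C 0) ^ 2 * (Polynomial.C (k 2 * (α - s * β) ^ 2)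
          * (Polynomial.C r + Polynomial.C β * Polynomial.X)) :=
      lineRest_eq_of_eval fun t => by
        rw [show r • (s • B 0 + x • B 1 + (1 : ℂ) • B 2) + t • (α • B 0 + β • (x • B 1 + B 2))
          = (r * s + t * α) • B 0 + (r + t * β) • (x • B 1 + B 2) by module, key]
        simp
        ring
    have hne : lineRest F (r • (s • B 0 + x • B 1 + (1 : ℂ) • B 2))
        (α • B 0 + β • (x • B 1 + B 2)) ≠ 0 := by
      rw [hline]
      refine mul_ne_zero (pow_ne_zero 2 (Polynomial.X_sub_C_ne_zero 0)) (mul_ne_zero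
        (Polynomial.C_ne_zero.2 (mul_ne_zero h2 (pow_ne_zero 2 hαβ))) fun h' => hr ?_)
      simpa using congrArg (Polynomial.eval 0) h'
    rw [multAt, Polynomial.le_rootMultiplicity_iff hne, hline]
    exact Dvd.intro _ rfl

theorem exists_isRoot_of_tangentAt
    (h : ∀ s x y : ℂ, eval (s • B 0 + x • B 1 + y • B 2) F = cubicForm k s x y)
    (h0 : k 0 = 0) (h1 : k 1 = 0) (h3 : k 3 ≠ 0) {S : Set P2} {q : P2}
    (hn : Projectivization.mk ℂ (B 0) (B.ne_zero 0) ∈ S)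
    (hq : q ≠ Projectivization.mk ℂ (B 0) (B.ne_zero 0)) (hT : TangentAt F S q) :
    ∃ x, (discPoly k).eval x = 0 ∧ S = lineThrough (B 0) (x • B 1 + B 2) := by
  obtain ⟨⟨u, v, huv, rfl⟩, hqS, -, hmult⟩ := hT
  induction q using Projectivization.ind with
  | h w hw =>
  obtain ⟨s, x, y, rfl⟩ := basis_combination B w
  rw [mk_mem_lineThrough] at hn hqS
  have hxy : ¬ (x = 0 ∧ y = 0) := by
    rintro ⟨rfl, rfl⟩
    exact hq ((Projectivization.mk_eq_mk_iff' ℂ _ _ _ _).2 ⟨s, by simp⟩)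
  have hli := LinearIndependent.pair_symm_iff.1
    (linearIndependent_pair_of_basis (B := B) (s := s) hxy)
  have hm := hmult _ _ hli (lineThrough_eq_of_mem huv hli hqS hn) hw rfl
  have hline : lineRest F (s • B 0 + x • B 1 + y • B 2) (B 0) =
      Polynomial.C (k 2 * y) * (Polynomial.C s + Polynomial.X) ^ 2
      + Polynomial.C (k 3 * x ^ 2 + k 4 * x * y + k 5 * y ^ 2) * (Polynomial.C s + Polynomial.X)
      + Polynomial.C (k 6 * x ^ 3 + k 7 * x ^ 2 * y + k 8 * x * y ^ 2 + k 9 * y ^ 3) :=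
    lineRest_eq_of_eval fun t => by
      rw [show s • B 0 + x • B 1 + y • B 2 + t • B 0 = (s + t) • B 0 + x • B 1 + y • B 2 by module,
        h, cubicForm, h0, h1]
      simp
      ring
  have hne : lineRest F (s • B 0 + x • B 1 + y • B 2) (B 0) ≠ 0 := by
    intro h'
    rw [multAt, h', Polynomial.rootMultiplicity_zero] at hm
    omega
  obtain ⟨e0, e1⟩ := (Polynomial.one_lt_rootMultiplicity_iff_isRoot hne).1 hm
  rw [Polynomial.IsRoot, hline] at e0 e1
  simp [Polynomial.derivative_pow] at e0 e1
  have hy : y ≠ 0 := by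
    rintro rfl
    simp [h3] at e1
    exact hxy ⟨e1, rfl⟩
  have hpt : (x / y) • B 1 + B 2 = (-(s / y)) • B 0 + y⁻¹ • (s • B 0 + x • B 1 + y • B 2) := by
    have : B 2 = (y⁻¹ * y) • B 2 := by rw [inv_mul_cancel₀ hy, one_smul]
    conv_lhs => rw [this]
    simp only [div_eq_mul_inv]
    module
  refine ⟨x / y, ?_, lineThrough_eq_of_mem huv ?_ hn ?_⟩
  · rw [eval_discPoly]
    field_simp
    linear_combination (k 3 * x ^ 2 + k 4 * x * y + k 5 * y ^ 2 + 2 * k 2 * y * s) * e1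
      - 4 * k 2 * y * e0
  · simpa using linearIndependent_pair_of_basis (B := B) (s := 0) (x := x / y) (y := 1) (by simp)
  · rw [hpt]
    exact add_mem (Submodule.smul_mem _ _ hn) (Submodule.smul_mem _ _ hqS)

theorem lineThrough_injective :
    Function.Injective fun x : ℂ => lineThrough (B 0) (x • B 1 + B 2) := by
  intro x x' hxx'
  have hli := linearIndependent_pair_of_basis (B := B) (s := 0) (x := x) (y := 1) (by simp)
  have hmem : x • B 1 + B 2 ∈ Submodule.span ℂ {B 0, x' • B 1 + B 2} := by
    rw [← mk_mem_lineThrough (by simpa using hli.ne_zero 1)]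
    beta_reduce at hxx'
    rw [← hxx', mk_mem_lineThrough]
    exact Submodule.subset_span (by simp)
  obtain ⟨p, r, hpr⟩ := Submodule.mem_span_pair.1 hmem
  obtain ⟨-, e1, e2⟩ := basis_combination_inj (B := B) (s := p) (x := r * x') (y := r)
    (s' := 0) (x' := x) (y' := 1) (by
      rw [zero_smul, zero_add, one_smul, ← hpr]
      module)
  rw [← e1, e2, one_mul]

end AdaptedBasis

/-- If `C` is a smooth plane cubic and `n ∈ C` is not an inflection
point (no line meets `C` at `n` with multiplicity `≥ 3`), then there are exactly four
lines through `n` tangent to `C` at some point `q ≠ n`. -/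
theorem four_tangent_lines_through_noninflection_point
    (F : MvPolynomial (Fin 3) ℂ) (hF0 : F ≠ 0) (hF3 : F.IsHomogeneous 3)
    (hsm : SmoothCurve F) (n : P2) (hn : n ∈ curve F)
    (hni : ∀ a b : Fin 3 → ℂ, LinearIndependent ℂ ![a, b] → ∀ ha : a ≠ 0,
      Projectivization.mk ℂ a ha = n → multAt F a b ≤ 2) :
    {S : Set P2 | IsLine S ∧ n ∈ S ∧ ∃ q : P2, q ≠ n ∧ TangentAt F S q}.ncard = 4 := by
  induction n using Projectivization.ind with
  | h a ha =>
  have hFa : eval a F = 0 := hn a ha rfl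
  have hga : grad F a a = 0 := by
    have := congrArg (eval a) hF3.sum_X_mul_pderiv
    simpa [grad_apply, hFa, mul_comm] using this
  obtain ⟨B, rfl, hb, hc⟩ := exists_adapted_basis ha (hsm.grad_ne_zero ha hFa) hga
  obtain ⟨k, h⟩ := exists_cubicForm hF3 B
  obtain ⟨-, g1, g2⟩ := grad_basis h 1 0 0
  have h0 : k 0 = 0 := by simpa [hFa, cubicForm] using (h 1 0 0).symm
  have h1 : k 1 = 0 := by simpa [hb] using g1.symm
  have h2 : k 2 ≠ 0 := by
    have : grad F (B 0) (B 2) = k 2 := by simpa using g2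
    rwa [← this]
  have h3 : k 3 ≠ 0 := by
    refine quadratic_coeff_ne_zero hsm h h0 h1 h2 (hni _ _ ?_ ha rfl)
    simpa using linearIndependent_pair_of_basis (B := B) (s := 0) (x := 1) (y := 0) (by simp)
  have hset : {S : Set P2 | IsLine S ∧ Projectivization.mk ℂ (B 0) ha ∈ S ∧
      ∃ q : P2, q ≠ Projectivization.mk ℂ (B 0) ha ∧ TangentAt F S q}
      = (fun x : ℂ => lineThrough (B 0) (x • B 1 + B 2)) '' (discPoly k).roots.toFinset := by
    have hD : discPoly k ≠ 0 := by
      intro hD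
      have := natDegree_discPoly h3
      simp [hD] at this
    ext S
    simp only [Set.mem_ofPred_eq, Set.mem_image, Finset.mem_coe, Multiset.mem_toFinset,
      Polynomial.mem_roots hD, Polynomial.IsRoot]
    constructor
    · rintro ⟨-, hnS, q, hq, hT⟩
      obtain ⟨x, hx, rfl⟩ := exists_isRoot_of_tangentAt h h0 h1 h3 hnS hq hT
      exact ⟨x, hx, rfl⟩
    · rintro ⟨x, hx, rfl⟩
      obtain ⟨q, hq, hT⟩ := tangentAt_of_isRoot h h0 h1 h2 hx
      exact ⟨hT.1, (mk_mem_lineThrough ha).2 (Submodule.subset_span (by simp)), q, hq, hT⟩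
  rw [hset, Set.ncard_image_of_injective _ lineThrough_injective, Set.ncard_coe_finset,
    card_roots_discPoly hsm h h0 h1 h2 h3]

end
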